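/- (Decisiveness in finite time) For every ε ∈ (0,1) there exists K = K(ε) ∈ ℕ such that for every pair (f,g) of probability measures on Ω^∞ and every n > 0, there is a measurable set S ⊆ Ω^∞ with f(S) ≥ 1 − ε such that for every ω ∈ S at least one of the following holds: (1) the pair (f,g) is ε-close along ω at all but at most K of the periods t ∈ {1,…,n}; or (2) lim_{t→∞} D_t(ω,f,g) exists and is > 1 − ε, and moreover |D_t(ω,f,g) − D_n(ω,f,g)| < ε for all t ≥ n. -/

import Mathlib

open MeasureTheory Filter Set
open scoped ENNReal

/-- The space Ω^∞ of infinite binary sequences. -/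
abbrev BinSeq : Type := ℕ → Bool

/-- The cylinder set `[ω^t]` of sequences agreeing with `ω` in the first `t` coordinates. -/
def cyl (ω : BinSeq) (t : ℕ) : Set BinSeq := {ω' | ∀ i < t, ω' i = ω i}

/-- A (candidate) cardinal comparison test: to each ordered pair of measures, each time `t`
and each realization `ω` it assigns a number. -/
abbrev Test : Type := Measure BinSeq → Measure BinSeq → ℕ → BinSeq → ℝ

/-- The σ-algebra on `BinSeq` generated by the first `t` coordinates. -/
def coordAlg (t : ℕ) : MeasurableSpace BinSeq :=
  MeasurableSpace.comap (fun ω (i : Fin t) => ω (i : ℕ)) inferInstance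

/-- A cardinal comparison test: values in `[0,1]`, and `T_t` is measurable with respect to the
σ-algebra generated by the first `t` coordinates, for every `t ≥ 1`. -/
def IsCCTest (T : Test) : Prop :=
  ∀ f g : Measure BinSeq, IsProbabilityMeasure f → IsProbabilityMeasure g →
    ∀ t : ℕ, 1 ≤ t →
      (∀ ω, T f g t ω ∈ Set.Icc (0:ℝ) 1) ∧ @Measurable BinSeq ℝ (coordAlg t) _ (T f g t)

/-- `L_{T,ε}^{(f,g)}`: the set of `ω` where `lim_t T_t(ω,f,g)` exists and is `> ε`. -/
def LSet (T : Test) (f g : Measure BinSeq) (ε : ℝ) : Set BinSeq :=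
  {ω | ∃ l : ℝ, Tendsto (fun t => T f g t ω) atTop (nhds l) ∧ ε < l}

/-- `R_{T,ε}^{(f,g)}`: the set of `ω` where `lim_t T_t(ω,f,g)` exists and is `< ε`. -/
def RSet (T : Test) (f g : Measure BinSeq) (ε : ℝ) : Set BinSeq :=
  {ω | ∃ l : ℝ, Tendsto (fun t => T f g t ω) atTop (nhds l) ∧ l < ε}

/-- Anonymity: `T_t(ω,f,g) = 1 - T_t(ω,g,f)`. -/
def Anonymous (T : Test) : Prop :=
  ∀ f g : Measure BinSeq, IsProbabilityMeasure f → IsProbabilityMeasure g →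
    ∀ t : ℕ, 1 ≤ t → ∀ ω, T f g t ω = 1 - T g f t ω

/-- Error-freeness. -/
def ErrorFree (T : Test) : Prop :=
  ∀ f g : Measure BinSeq, IsProbabilityMeasure f → IsProbabilityMeasure g →
    ∀ A : Set BinSeq, MeasurableSet A →
      (∀ ε : ℝ, ε ∈ Set.Ioo 0 (1/2) →
        f (A ∩ RSet T f g ε) ≤ ENNReal.ofReal (ε / (1 - ε)) * g (A ∩ RSet T f g ε)) ∧
      (∀ ε : ℝ, ε ∈ Set.Ioo (1/2) 1 →
        g (A ∩ LSet T f g ε) ≤ ENNReal.ofReal ((1 - ε) / ε) * f (A ∩ LSet T f g ε))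

/-- Reasonableness. -/
def Reasonable (T : Test) : Prop :=
  ∀ f g : Measure BinSeq, IsProbabilityMeasure f → IsProbabilityMeasure g →
    ∀ A : Set BinSeq, MeasurableSet A →
      (∀ ε : ℝ, ε ∈ Set.Ioo 0 (1/2) →
        0 < g A → f A < ENNReal.ofReal (ε / (1 - ε)) * g A →
          0 < g (A ∩ RSet T f g ε)) ∧
      (∀ ε : ℝ, ε ∈ Set.Ioo (1/2) 1 →
        0 < f A → g A < ENNReal.ofReal ((1 - ε) / ε) * f A →
          0 < f (A ∩ LSet T f g ε))

/-- The finite derivative test `D`. -/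
noncomputable def Dtest : Test := fun f g t ω =>
  match t with
  | 0 => 1/2
  | Nat.succ s =>
      if 0 < f (cyl ω s) + g (cyl ω s) then
        (f (cyl ω s)).toReal / ((f (cyl ω s)).toReal + (g (cyl ω s)).toReal)
      else 1/2


open scoped Classical in
/-- The one-step-ahead forecast of `f` along `ω` at period `t+1`. -/
noncomputable def forecast (f : Measure BinSeq) (ω : BinSeq) (t : ℕ) : ℝ :=
  if f (cyl ω t) ≠ 0 then (f (cyl ω (t+1))).toReal / (f (cyl ω t)).toReal else 1/2

/-- The pair `(f,g)` is `ε`-close along `ω` at period `t+1`. -/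
def EpsClose (f g : Measure BinSeq) (ω : BinSeq) (ε : ℝ) (t : ℕ) : Prop :=
  |forecast f ω t - forecast g ω t| < ε

lemma cyl_eq_of_mem {ω ω' : BinSeq} {t : ℕ} (h : ω' ∈ cyl ω t) : cyl ω' t = cyl ω t := by
  ext x
  exact ⟨fun hx i hi => (hx i hi).trans (h i hi), fun hx i hi => (hx i hi).trans (h i hi).symm⟩

lemma cyl_antitone (ω : BinSeq) : Antitone (cyl ω) :=
  fun _ _ hst _ hx i hi => hx i (hi.trans_le hst)

/-- The first `t` coordinates of a sequence. -/
def initSeg (t : ℕ) (ω : BinSeq) : Fin t → Bool := fun i => ω i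

lemma measurable_initSeg (t : ℕ) : Measurable (initSeg t) :=
  measurable_pi_lambda _ fun i => measurable_pi_apply (i : ℕ)

lemma cyl_eq_preimage (ω : BinSeq) (t : ℕ) : cyl ω t = initSeg t ⁻¹' {initSeg t ω} := by
  ext x
  simp only [cyl, initSeg, mem_ofPred_eq, mem_preimage, mem_singleton_iff, funext_iff]
  exact ⟨fun h i => h i i.2, fun h i hi => h ⟨i, hi⟩⟩

lemma coordAlg_le (t : ℕ) : coordAlg t ≤ (inferInstance : MeasurableSpace BinSeq) :=
  (measurable_initSeg t).comap_le

lemma exists_eq_comp_initSeg {α : Type*} {t : ℕ} {h : BinSeq → α}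
    (hh : ∀ ω, ∀ ω' ∈ cyl ω t, h ω' = h ω) : ∃ G : (Fin t → Bool) → α, h = G ∘ initSeg t := by
  refine ⟨fun x => h fun i => if hi : i < t then x ⟨i, hi⟩ else false, ?_⟩
  ext ω
  symm
  apply hh
  intro i hi
  simp [hi, initSeg]

lemma coordAlg_mono : Monotone coordAlg := by
  intro s t hst
  rw [coordAlg, MeasurableSpace.comap_le_iff_le_map]
  change Measurable[coordAlg t] _
  refine @measurable_pi_lambda _ _ _ (coordAlg t) _ _ fun i => ?_
  exact (measurable_pi_apply (⟨i, i.2.trans_le hst⟩ : Fin t)).comp (comap_measurable (initSeg t))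

/-- The filtration of the coordinate process. -/
def coordFiltration : Filtration ℕ (inferInstance : MeasurableSpace BinSeq) where
  seq := coordAlg
  mono' := coordAlg_mono
  le' := coordAlg_le

lemma Dtest_succ (f g : Measure BinSeq) [IsFiniteMeasure f] [IsFiniteMeasure g] (t : ℕ)
    (ω : BinSeq) :
    Dtest f g (t + 1) ω = if 0 < f.real (cyl ω t) + g.real (cyl ω t) then
      f.real (cyl ω t) / (f.real (cyl ω t) + g.real (cyl ω t)) else 1 / 2 := by
  have : 0 < f (cyl ω t) + g (cyl ω t) ↔ 0 < f.real (cyl ω t) + g.real (cyl ω t) := by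
    rw [Measure.real, Measure.real, ← ENNReal.toReal_add (by finiteness) (by finiteness),
      ENNReal.toReal_pos_iff]
    exact ⟨fun h => ⟨h, by finiteness⟩, fun h => h.1⟩
  simp only [Dtest, this]
  rfl

lemma Dtest_succ_ae_eq_condExp (f g : Measure BinSeq) [IsFiniteMeasure f] [IsFiniteMeasure g]
    (t : ℕ) :
    Dtest f g (t + 1) =ᵐ[f + g] (f + g)[fun ω => (f.rnDeriv (f + g) ω).toReal | coordAlg t] := by
  have hac : f ≪ f + g := Measure.absolutelyContinuous_of_le (Measure.le_add_right le_rfl)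
  obtain ⟨G, hG⟩ := exists_eq_comp_initSeg (t := t) (h := Dtest f g (t + 1)) <| by
    intro ω ω' h
    simp only [Dtest, cyl_eq_of_mem h]
  have hmeas : Measurable[coordAlg t] (Dtest f g (t + 1)) := by
    rw [hG]
    exact (measurable_of_finite G).comp (comap_measurable _)
  have hbound (ω) : ‖Dtest f g (t + 1) ω‖ ≤ 1 := by
    rw [Dtest_succ]
    have h1 : 0 ≤ f.real (cyl ω t) := measureReal_nonneg
    have h2 : 0 ≤ g.real (cyl ω t) := measureReal_nonneg
    split_ifs with h
    · rw [Real.norm_of_nonneg (by positivity), div_le_one h]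
      linarith
    · norm_num
  have hint : Integrable (Dtest f g (t + 1)) (f + g) :=
    Integrable.of_bound (hmeas.mono (coordAlg_le t) le_rfl).aestronglyMeasurable 1
      (.of_forall hbound)
  refine ae_eq_condExp_of_forall_setIntegral_eq (coordAlg_le t) Measure.integrable_toReal_rnDeriv
    (fun _ _ _ => hint.integrableOn) ?_ hmeas.stronglyMeasurable.aestronglyMeasurable
  rintro s ⟨B, hB, rfl⟩ -
  change ∫ ω in initSeg t ⁻¹' B, _ ∂_ = ∫ ω in initSeg t ⁻¹' B, _ ∂_
  classical
  rw [Measure.setIntegral_toReal_rnDeriv hac, hG]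
  simp only [Function.comp_apply]
  rw [← setIntegral_map hB (measurable_of_finite G).aestronglyMeasurable
      (measurable_initSeg t).aemeasurable,
    ← map_measureReal_apply (measurable_initSeg t) hB]
  obtain ⟨B, rfl⟩ := B.toFinite.exists_finset_coe
  rw [setIntegral_finset _ (Integrable.of_finite).integrableOn, ← sum_measureReal_singleton]
  refine Finset.sum_congr rfl fun x _ => ?_
  obtain ⟨ω, rfl⟩ : ∃ ω, initSeg t ω = x :=
    ⟨fun i => if hi : i < t then x ⟨i, hi⟩ else false, by ext i; simp [initSeg]⟩
  have hGω : G (initSeg t ω) = Dtest f g (t + 1) ω := by rw [hG]; rfl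
  rw [hGω, map_measureReal_apply (measurable_initSeg t) (measurableSet_singleton _),
    map_measureReal_apply (measurable_initSeg t) (measurableSet_singleton _),
    ← cyl_eq_preimage, measureReal_add_apply, Dtest_succ, smul_eq_mul]
  have h1 : 0 ≤ f.real (cyl ω t) := measureReal_nonneg
  have h2 : 0 ≤ g.real (cyl ω t) := measureReal_nonneg
  split_ifs with h
  · field_simp
  · nlinarith

lemma ae_exists_tendsto_Dtest (f g : Measure BinSeq) [IsFiniteMeasure f] [IsFiniteMeasure g] :
    ∀ᵐ ω ∂f, ∃ l, Tendsto (fun t => Dtest f g t ω) atTop (nhds l) := by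
  have hac : f ≪ f + g := Measure.absolutelyContinuous_of_le (Measure.le_add_right le_rfl)
  apply hac.ae_le
  have h := tendsto_ae_condExp (μ := f + g) (ℱ := coordFiltration)
    fun ω => (f.rnDeriv (f + g) ω).toReal
  filter_upwards [h, ae_all_iff.2 (Dtest_succ_ae_eq_condExp f g)] with ω hω hD
  refine ⟨_, (tendsto_add_atTop_iff_nat 1).1 (hω.congr fun t => (hD t).symm)⟩

lemma cyl_update (ω : BinSeq) (t : ℕ) (b : Bool) :
    cyl (Function.update ω t b) (t + 1) = cyl ω t ∩ {ω' | ω' t = b} := by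
  ext x
  constructor
  · intro h
    refine ⟨fun i hi => ?_, ?_⟩
    · rw [h i (by omega), Function.update_of_ne hi.ne]
    · simpa using h t (by omega)
  · rintro ⟨h, hb⟩ i hi
    rcases Nat.lt_succ_iff_lt_or_eq.1 hi with hi | rfl
    · rw [h i hi, Function.update_of_ne hi.ne]
    · simpa using hb

lemma measureReal_cyl_update_add (f : Measure BinSeq) [IsFiniteMeasure f] (ω : BinSeq) (t : ℕ) :
    f.real (cyl (Function.update ω t false) (t + 1)) +
      f.real (cyl (Function.update ω t true) (t + 1)) = f.real (cyl ω t) := by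
  have hm : MeasurableSet {ω' : BinSeq | ω' t = false} :=
    (measurable_pi_apply (X := fun _ : ℕ => Bool) t) (measurableSet_singleton false)
  rw [cyl_update, cyl_update, ← measureReal_inter_add_sdiff (s := cyl ω t) hm]
  congr 2
  ext x
  simp

/-- Maximal inequality for a nonnegative function on cylinders that is superadditive
along the binary tree. -/
lemma mul_measureReal_exists_le_of_tree (f : Measure BinSeq) [IsFiniteMeasure f]
    {A : ℕ → BinSeq → ℝ} (hA0 : ∀ t ω, 0 ≤ A t ω) (hA : ∀ t ω, ∀ ω' ∈ cyl ω t, A t ω' = A t ω)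
    (hsuper : ∀ t ω, A (t + 1) (Function.update ω t false) +
      A (t + 1) (Function.update ω t true) ≤ A t ω) {c : ℝ} (hc : 0 ≤ c) (k t : ℕ)
    (ω : BinSeq) :
    c * f.real (cyl ω t ∩ {ω' | ∃ s, t ≤ s ∧ s ≤ t + k ∧ c * f.real (cyl ω' s) ≤ A s ω'}) ≤
      A t ω := by
  induction k generalizing t ω with
  | zero =>
    by_cases h : c * f.real (cyl ω t) ≤ A t ω
    · exact (mul_le_mul_of_nonneg_left (measureReal_mono inter_subset_left) hc).trans h
    · have : cyl ω t ∩ {ω' | ∃ s, t ≤ s ∧ s ≤ t + 0 ∧ c * f.real (cyl ω' s) ≤ A s ω'} = ∅ := by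
        rw [eq_empty_iff_forall_notMem]
        rintro ω' ⟨hω', s, h1, h2, h3⟩
        obtain rfl : s = t := by omega
        rw [cyl_eq_of_mem hω', hA _ _ _ hω'] at h3
        exact h h3
      rw [this]
      simpa using hA0 t ω
  | succ k ih =>
    by_cases h : c * f.real (cyl ω t) ≤ A t ω
    · exact (mul_le_mul_of_nonneg_left (measureReal_mono inter_subset_left) hc).trans h
    · set E := {ω' | ∃ s, t + 1 ≤ s ∧ s ≤ t + 1 + k ∧ c * f.real (cyl ω' s) ≤ A s ω'} with hE
      have hsub : cyl ω t ∩ {ω' | ∃ s, t ≤ s ∧ s ≤ t + (k + 1) ∧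
          c * f.real (cyl ω' s) ≤ A s ω'} ⊆
          (cyl (Function.update ω t false) (t + 1) ∩ E) ∪
            (cyl (Function.update ω t true) (t + 1) ∩ E) := by
        rintro ω' ⟨hω', s, h1, h2, h3⟩
        have hs : s ≠ t := by
          rintro rfl
          rw [cyl_eq_of_mem hω', hA _ _ _ hω'] at h3
          exact h h3
        have hmem : ω' ∈ E := ⟨s, by omega, by omega, h3⟩
        rw [cyl_update, cyl_update]
        cases hb : ω' t
        · exact .inl ⟨⟨hω', hb⟩, hmem⟩
        · exact .inr ⟨⟨hω', hb⟩, hmem⟩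
      have h1 := (measureReal_mono (μ := f) hsub).trans (measureReal_union_le _ _)
      have h2 := mul_le_mul_of_nonneg_left h1 hc
      have h3 := ih (t + 1) (Function.update ω t false)
      have h4 := ih (t + 1) (Function.update ω t true)
      have h5 := hsuper t ω
      linarith

lemma mul_measureReal_exists_le (f : Measure BinSeq) [IsFiniteMeasure f]
    {A : ℕ → BinSeq → ℝ} (hA0 : ∀ t ω, 0 ≤ A t ω) (hA : ∀ t ω, ∀ ω' ∈ cyl ω t, A t ω' = A t ω)
    (hsuper : ∀ t ω, A (t + 1) (Function.update ω t false) +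
      A (t + 1) (Function.update ω t true) ≤ A t ω) {c : ℝ} (hc : 0 ≤ c) (ω : BinSeq) :
    c * f.real {ω' | ∃ s, c * f.real (cyl ω' s) ≤ A s ω'} ≤ A 0 ω := by
  set E : ℕ → Set BinSeq := fun k => {ω' | ∃ s ≤ k, c * f.real (cyl ω' s) ≤ A s ω'}
  have hmono : Monotone E := fun j k hjk ω' ⟨s, hs, h⟩ => ⟨s, hs.trans hjk, h⟩
  have hE : {ω' | ∃ s, c * f.real (cyl ω' s) ≤ A s ω'} = ⋃ k, E k := by
    ext ω'
    simp only [mem_ofPred_eq, mem_iUnion, E]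
    exact ⟨fun ⟨s, h⟩ => ⟨s, s, le_rfl, h⟩, fun ⟨_, s, _, h⟩ => ⟨s, h⟩⟩
  have hlim : Tendsto (fun k => f.real (E k)) atTop (nhds (f.real (⋃ k, E k))) :=
    (ENNReal.tendsto_toReal (by finiteness)).comp (tendsto_measure_iUnion_atTop hmono)
  rw [hE]
  refine le_of_tendsto (hlim.const_mul c) (.of_forall fun k => ?_)
  simpa [cyl, E] using mul_measureReal_exists_le_of_tree f hA0 hA hsuper hc k 0 ω

/-- Hellinger affinity of two-point distributions, in homogeneous form. -/
lemma sqrt_mul_add_sqrt_mul_le {a₀ a₁ b₀ b₁ r : ℝ} (ha₀ : 0 ≤ a₀) (ha₁ : 0 ≤ a₁) (hb₀ : 0 ≤ b₀)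
    (hb₁ : 0 ≤ b₁)
    (hr : r * ((a₀ + a₁) * (b₀ + b₁)) ^ 2 ≤ (a₀ * b₁ - a₁ * b₀) ^ 2) :
    √(a₀ * b₀) + √(a₁ * b₁) ≤ √(1 - r) * √((a₀ + a₁) * (b₀ + b₁)) := by
  have hP : 0 ≤ (a₀ + a₁) * (b₀ + b₁) := by positivity
  rcases hP.eq_or_lt with hP | hP
  · have h₀ : a₀ * b₀ = 0 := by
      nlinarith [mul_nonneg ha₀ hb₀, mul_nonneg ha₀ hb₁,
        mul_nonneg ha₁ hb₀, mul_nonneg ha₁ hb₁]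
    have h₁ : a₁ * b₁ = 0 := by
      nlinarith [mul_nonneg ha₀ hb₀, mul_nonneg ha₀ hb₁,
        mul_nonneg ha₁ hb₀, mul_nonneg ha₁ hb₁]
    simp [h₀, h₁, ← hP]
  rw [← Real.sqrt_mul' _ hP.le]
  apply Real.le_sqrt_of_sq_le
  refine le_of_mul_le_mul_right ?_ hP
  have hx := Real.sq_sqrt (mul_nonneg ha₀ hb₀)
  have hy := Real.sq_sqrt (mul_nonneg ha₁ hb₁)
  have hw := Real.sq_sqrt (mul_nonneg ha₀ hb₁)
  have hz := Real.sq_sqrt (mul_nonneg ha₁ hb₀)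
  have hxy : √(a₀ * b₀) * √(a₁ * b₁) = √(a₀ * b₁) * √(a₁ * b₀) := by
    rw [← Real.sqrt_mul (mul_nonneg ha₀ hb₀), ← Real.sqrt_mul (mul_nonneg ha₀ hb₁)]
    ring_nf
  set x := √(a₀ * b₀)
  set y := √(a₁ * b₁)
  set w := √(a₀ * b₁)
  set z := √(a₁ * b₀)
  have hPeq : (a₀ + a₁) * (b₀ + b₁) = x ^ 2 + y ^ 2 + w ^ 2 + z ^ 2 := by
    rw [hx, hy, hw, hz]
    ring
  rw [hPeq] at hr ⊢
  rw [← hw, ← hz] at hr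
  have hsum : (x + y) ^ 2 = x ^ 2 + y ^ 2 + w ^ 2 + z ^ 2 - (w - z) ^ 2 := by
    linear_combination 2 * hxy
  have hP' : x ^ 2 + y ^ 2 + w ^ 2 + z ^ 2 = (x - y) ^ 2 + (w + z) ^ 2 := by
    linear_combination 2 * hxy
  have h : (w ^ 2 - z ^ 2) ^ 2 ≤ (w - z) ^ 2 * (x ^ 2 + y ^ 2 + w ^ 2 + z ^ 2) := by
    rw [hP']
    nlinarith [mul_nonneg (sq_nonneg (w - z)) (sq_nonneg (x - y))]
  rw [hsum]
  nlinarith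

open scoped Classical in
/-- The number of periods among the first `t` at which `f` and `g` are not `ε`-close. -/
noncomputable def farCount (f g : Measure BinSeq) (ε : ℝ) (t : ℕ) (ω : BinSeq) : ℕ :=
  ((Finset.range t).filter (fun s => ¬ EpsClose f g ω ε s)).card

open scoped Classical in
lemma farCount_succ (f g : Measure BinSeq) (ε : ℝ) (t : ℕ) (ω : BinSeq) :
    farCount f g ε (t + 1) ω = farCount f g ε t ω + if EpsClose f g ω ε t then 0 else 1 := by
  simp only [farCount, Finset.card_filter, Finset.sum_range_succ]
  congr 1
  split_ifs <;> rfl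

lemma farCount_mono (f g : Measure BinSeq) (ε : ℝ) (ω : BinSeq) :
    Monotone fun t => farCount f g ε t ω :=
  monotone_nat_of_le_succ fun t => by simp [farCount_succ]

lemma forecast_eq_of_mem_cyl (f : Measure BinSeq) {ω ω' : BinSeq} {s t : ℕ} (hst : s < t)
    (h : ω' ∈ cyl ω t) : forecast f ω' s = forecast f ω s := by
  simp only [forecast, cyl_eq_of_mem (cyl_antitone ω hst.le h),
    cyl_eq_of_mem (cyl_antitone ω (Nat.succ_le_of_lt hst) h)]

lemma farCount_eq_of_mem_cyl (f g : Measure BinSeq) (ε : ℝ) {ω ω' : BinSeq} {t : ℕ}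
    (h : ω' ∈ cyl ω t) : farCount f g ε t ω' = farCount f g ε t ω := by
  classical
  simp only [farCount]
  congr 1
  refine Finset.filter_congr fun s hs => ?_
  have hs := Finset.mem_range.1 hs
  simp only [EpsClose, forecast_eq_of_mem_cyl f hs h, forecast_eq_of_mem_cyl g hs h]

lemma update_mem_cyl (ω : BinSeq) (t : ℕ) (b : Bool) : Function.update ω t b ∈ cyl ω t :=
  fun _ hi => Function.update_of_ne hi.ne _ _

lemma forecast_update (f : Measure BinSeq) [IsFiniteMeasure f] (ω : BinSeq) (t : ℕ) (b : Bool)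
    (h : f.real (cyl ω t) ≠ 0) : forecast f (Function.update ω t b) t =
      f.real (cyl (Function.update ω t b) (t + 1)) / f.real (cyl ω t) := by
  have h' : f (cyl ω t) ≠ 0 := fun h0 => h (by simp [Measure.real, h0])
  simp only [forecast, cyl_eq_of_mem (update_mem_cyl ω t b), if_pos h']
  rfl

/-- The square root of the likelihood ratio of `g` to `f`, times the `f`-probability of the
cylinder, discounted by a factor for every period without `ε`-closeness. -/
noncomputable def discountedAffinity (f g : Measure BinSeq) (ε : ℝ) (t : ℕ) (ω : BinSeq) : ℝ :=
  √(f.real (cyl ω t) * g.real (cyl ω t)) / √(1 - ε ^ 2) ^ farCount f g ε t ω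

lemma discountedAffinity_nonneg (f g : Measure BinSeq) (ε : ℝ) (t : ℕ) (ω : BinSeq) :
    0 ≤ discountedAffinity f g ε t ω := by
  unfold discountedAffinity
  positivity

lemma discountedAffinity_eq_of_mem_cyl (f g : Measure BinSeq) (ε : ℝ) {ω ω' : BinSeq} {t : ℕ}
    (h : ω' ∈ cyl ω t) : discountedAffinity f g ε t ω' = discountedAffinity f g ε t ω := by
  simp only [discountedAffinity, cyl_eq_of_mem h, farCount_eq_of_mem_cyl f g ε h]

lemma discountedAffinity_update_add_le (f g : Measure BinSeq) [IsFiniteMeasure f]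
    [IsFiniteMeasure g] {ε : ℝ} (hε : ε ∈ Ioo (0 : ℝ) 1) (t : ℕ) (ω : BinSeq) :
    discountedAffinity f g ε (t + 1) (Function.update ω t false) +
      discountedAffinity f g ε (t + 1) (Function.update ω t true) ≤
        discountedAffinity f g ε t ω := by
  classical
  have hc : 0 < √(1 - ε ^ 2) := Real.sqrt_pos.2 (by nlinarith [hε.1, hε.2])
  have hf := measureReal_cyl_update_add f ω t
  have hg := measureReal_cyl_update_add g ω t
  have hff := forecast_update f ω t false
  have hft := forecast_update f ω t true
  have hgf := forecast_update g ω t false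
  have hgt := forecast_update g ω t true
  have hNf := farCount_eq_of_mem_cyl f g ε (update_mem_cyl ω t false)
  have hNt := farCount_eq_of_mem_cyl f g ε (update_mem_cyl ω t true)
  simp only [discountedAffinity, farCount_succ, hNf, hNt]
  have ha₀ : 0 ≤ f.real (cyl (Function.update ω t false) (t + 1)) := measureReal_nonneg
  have ha₁ : 0 ≤ f.real (cyl (Function.update ω t true) (t + 1)) := measureReal_nonneg
  have hb₀ : 0 ≤ g.real (cyl (Function.update ω t false) (t + 1)) := measureReal_nonneg
  have hb₁ : 0 ≤ g.real (cyl (Function.update ω t true) (t + 1)) := measureReal_nonneg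
  generalize f.real (cyl (Function.update ω t false) (t + 1)) = a₀ at *
  generalize f.real (cyl (Function.update ω t true) (t + 1)) = a₁ at *
  generalize g.real (cyl (Function.update ω t false) (t + 1)) = b₀ at *
  generalize g.real (cyl (Function.update ω t true) (t + 1)) = b₁ at *
  rw [← hf] at hff hft ⊢
  rw [← hg] at hgf hgt ⊢
  by_cases ha : a₀ + a₁ = 0
  · obtain ⟨rfl, rfl⟩ := (add_eq_zero_iff_of_nonneg ha₀ ha₁).1 ha
    simp
  by_cases hb : b₀ + b₁ = 0
  · obtain ⟨rfl, rfl⟩ := (add_eq_zero_iff_of_nonneg hb₀ hb₁).1 hb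
    simp
  have hcompl : a₁ / (a₀ + a₁) - b₁ / (b₀ + b₁) = -(a₀ / (a₀ + a₁) - b₀ / (b₀ + b₁)) := by
    field_simp
    ring
  have hclose₀ : EpsClose f g (Function.update ω t false) ε t ↔
      |a₀ / (a₀ + a₁) - b₀ / (b₀ + b₁)| < ε := by
    rw [EpsClose, hff ha, hgf hb]
  have hclose₁ : EpsClose f g (Function.update ω t true) ε t ↔
      |a₀ / (a₀ + a₁) - b₀ / (b₀ + b₁)| < ε := by
    rw [EpsClose, hft ha, hgt hb, hcompl, abs_neg]
  simp only [hclose₀, hclose₁]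
  split_ifs with h
  · rw [← add_div, add_zero]
    gcongr
    have := sqrt_mul_add_sqrt_mul_le (r := 0) ha₀ ha₁ hb₀ hb₁ <| by
      simpa using sq_nonneg (a₀ * b₁ - a₁ * b₀)
    simpa using this
  · have hdiff : (a₀ / (a₀ + a₁) - b₀ / (b₀ + b₁)) * ((a₀ + a₁) * (b₀ + b₁)) =
        a₀ * b₁ - a₁ * b₀ := by
      field_simp
      ring
    have hsq : ε ^ 2 ≤ (a₀ / (a₀ + a₁) - b₀ / (b₀ + b₁)) ^ 2 := by
      rw [← sq_abs (a₀ / (a₀ + a₁) - b₀ / (b₀ + b₁))]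
      exact pow_le_pow_left₀ hε.1.le (not_lt.1 h) 2
    have hle := sqrt_mul_add_sqrt_mul_le (r := ε ^ 2) ha₀ ha₁ hb₀ hb₁ <| by
      rw [← hdiff, mul_pow (_ - _)]
      exact mul_le_mul_of_nonneg_right hsq (sq_nonneg _)
    rw [← add_div, pow_succ, div_le_div_iff₀ (by positivity) (by positivity)]
    calc _ ≤ √(1 - ε ^ 2) * √((a₀ + a₁) * (b₀ + b₁)) * √(1 - ε ^ 2) ^ farCount f g ε t ω := by
          gcongr
      _ = _ := by ring

lemma measurable_of_eq_on_cyl {t : ℕ} {h : BinSeq → ℝ} (hh : ∀ ω, ∀ ω' ∈ cyl ω t, h ω' = h ω) :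
    Measurable h := by
  obtain ⟨G, rfl⟩ := exists_eq_comp_initSeg hh
  exact (measurable_of_finite G).comp (measurable_initSeg t)

lemma Dtest_mem_Icc_of_le_mul (f g : Measure BinSeq) [IsFiniteMeasure f] [IsFiniteMeasure g]
    {t : ℕ} {ω : BinSeq} {δ : ℝ} (hf : 0 < f.real (cyl ω t))
    (h : g.real (cyl ω t) ≤ δ * f.real (cyl ω t)) : Dtest f g (t + 1) ω ∈ Icc (1 - δ) 1 := by
  have hg : 0 ≤ g.real (cyl ω t) := measureReal_nonneg
  rw [Dtest_succ, if_pos (by positivity)]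
  constructor
  · rw [le_div_iff₀ (by positivity)]
    have hδ : 0 ≤ δ := by
      by_contra! hδ
      nlinarith
    nlinarith
  · rw [div_le_one (by positivity)]
    linarith

/-- If the discounted affinity is small and the forecasts were often far apart, then the
likelihood ratio is small. -/
lemma measureReal_le_of_discountedAffinity_lt (f g : Measure BinSeq) [IsFiniteMeasure f]
    [IsFiniteMeasure g] {ε : ℝ} (hε : ε ∈ Ioo (0 : ℝ) 1) {t M : ℕ} {ω : BinSeq}
    (hM : M ≤ farCount f g ε t ω)
    (h : discountedAffinity f g ε t ω < 1 / ε * f.real (cyl ω t)) :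
    0 < f.real (cyl ω t) ∧
      g.real (cyl ω t) ≤ (1 - ε ^ 2) ^ M / ε ^ 2 * f.real (cyl ω t) := by
  have hε0 := hε.1
  have hr : 0 < 1 - ε ^ 2 := by nlinarith [hε.1, hε.2]
  have hc : 0 < √(1 - ε ^ 2) := Real.sqrt_pos.2 hr
  have hg0 : 0 ≤ g.real (cyl ω t) := measureReal_nonneg
  have hf0 : 0 < f.real (cyl ω t) :=
    pos_of_mul_pos_right ((discountedAffinity_nonneg f g ε t ω).trans_lt h) (by positivity)
  refine ⟨hf0, ?_⟩
  have hpow : (√(1 - ε ^ 2) ^ farCount f g ε t ω) ^ 2 ≤ (1 - ε ^ 2) ^ M := by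
    rw [← pow_mul, mul_comm, pow_mul, Real.sq_sqrt hr.le]
    exact pow_le_pow_of_le_one hr.le (by nlinarith) hM
  rw [discountedAffinity, div_lt_iff₀ (by positivity)] at h
  have hsq := pow_le_pow_left₀ (Real.sqrt_nonneg _) h.le 2
  rw [Real.sq_sqrt (by positivity), mul_pow] at hsq
  refine le_of_mul_le_mul_left ?_ hf0
  calc _ ≤ (1 / ε * f.real (cyl ω t)) ^ 2 * (√(1 - ε ^ 2) ^ farCount f g ε t ω) ^ 2 := hsq
    _ ≤ (1 / ε * f.real (cyl ω t)) ^ 2 * (1 - ε ^ 2) ^ M := by gcongr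
    _ = _ := by field_simp

open scoped Classical in
/-- Decisiveness in finite time: a uniform bound `K = K(ε)` such that, with `f`-probability at
least `1-ε`, either the two forecasters are `ε`-close in all but at most `K` of the first `n`
periods, or the finite derivative test has settled (above `1-ε`, within `ε` of its value at
time `n`) from time `n` onwards. -/
theorem stmt12 (ε : ℝ) (hε : ε ∈ Set.Ioo 0 1) :
    ∃ K : ℕ, ∀ f g : Measure BinSeq, IsProbabilityMeasure f → IsProbabilityMeasure g →
      ∀ n : ℕ, 0 < n →
        ∃ S : Set BinSeq, MeasurableSet S ∧ ENNReal.ofReal (1 - ε) ≤ f S ∧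
          ∀ ω ∈ S,
            ((Finset.range n).filter (fun t => ¬ EpsClose f g ω ε t)).card ≤ K ∨
            ((∃ l : ℝ, Tendsto (fun t => Dtest f g t ω) atTop (nhds l) ∧ 1 - ε < l) ∧
              ∀ t : ℕ, n ≤ t → |Dtest f g t ω - Dtest f g n ω| < ε) := by
  have hε0 := hε.1
  have hr : 0 < 1 - ε ^ 2 := by nlinarith [hε.1, hε.2]
  obtain ⟨M, hM⟩ := exists_pow_lt_of_lt_one (show 0 < ε ^ 2 * (ε / 2) by positivity)
    (show 1 - ε ^ 2 < 1 by nlinarith)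
  have hδ : (1 - ε ^ 2) ^ M / ε ^ 2 < ε / 2 := by
    rw [div_lt_iff₀ (by positivity)]
    linarith
  refine ⟨M, fun f g hf hg n hn => ?_⟩
  set A := discountedAffinity f g ε
  set B := {ω | ∃ s, 1 / ε * f.real (cyl ω s) ≤ A s ω} with hB
  have hBmeas : MeasurableSet B := by
    rw [hB, ofPred_exists]
    refine MeasurableSet.iUnion fun s => measurableSet_le (measurable_of_eq_on_cyl (t := s) ?_)
      (measurable_of_eq_on_cyl (t := s) fun ω ω' => discountedAffinity_eq_of_mem_cyl f g ε)
    intro ω ω' h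
    rw [cyl_eq_of_mem h]
  have hBle : f.real B ≤ ε := by
    have h := mul_measureReal_exists_le f (discountedAffinity_nonneg f g ε)
      (fun t ω ω' => discountedAffinity_eq_of_mem_cyl f g ε)
      (discountedAffinity_update_add_le f g hε) (c := 1 / ε) (by positivity) (fun _ => false)
    have h0 : discountedAffinity f g ε 0 (fun _ => false) = 1 := by
      simp [discountedAffinity, farCount, cyl]
    rw [h0] at h
    rwa [← hB, one_div_mul_eq_div, div_le_one hε0] at h
  obtain ⟨T, hTB, hTmeas, hT0⟩ := exists_measurable_superset_of_null (ae_exists_tendsto_Dtest f g)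
  refine ⟨(B ∪ T)ᶜ, (hBmeas.union hTmeas).compl, ?_, fun ω hω => ?_⟩
  · have hle : f.real (B ∪ T) ≤ ε := by
      rwa [measureReal_congr (union_ae_eq_left_of_ae_eq_empty (ae_eq_empty.2 hT0))]
    rw [← ofReal_measureReal, probReal_compl_eq_one_sub (hBmeas.union hTmeas)]
    exact ENNReal.ofReal_le_ofReal (by linarith)
  · rw [mem_compl_iff, mem_union, not_or] at hω
    obtain ⟨hωB, hωT⟩ := hω
    have hA (s) : A s ω < 1 / ε * f.real (cyl ω s) := not_le.1 fun h => hωB ⟨s, h⟩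
    obtain ⟨l, hl⟩ : ∃ l, Tendsto (fun t => Dtest f g t ω) atTop (nhds l) := by
      by_contra h
      exact hωT (hTB h)
    refine or_iff_not_imp_left.2 fun hcard => ?_
    change ¬ farCount f g ε n ω ≤ M at hcard
    obtain ⟨m, rfl⟩ := Nat.exists_eq_succ_of_ne_zero hn.ne'
    have hm : M ≤ farCount f g ε m ω := by
      rw [Nat.succ_eq_add_one, farCount_succ] at hcard
      split_ifs at hcard <;> omega
    have hD : ∀ t, m + 1 ≤ t → Dtest f g t ω ∈ Icc (1 - (1 - ε ^ 2) ^ M / ε ^ 2) 1 := by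
      intro t ht
      obtain ⟨s, rfl⟩ : ∃ s, t = s + 1 := ⟨t - 1, by omega⟩
      obtain ⟨h1, h2⟩ := measureReal_le_of_discountedAffinity_lt f g hε
        (hm.trans (farCount_mono f g ε ω (by omega : m ≤ s))) (hA s)
      exact Dtest_mem_Icc_of_le_mul f g h1 h2
    refine ⟨⟨l, hl, ?_⟩, fun t ht => ?_⟩
    · have := ge_of_tendsto hl ((eventually_ge_atTop (m + 1)).mono fun t ht => (hD t ht).1)
      linarith
    · have h1 := hD t ht
      have h2 := hD (m + 1) le_rfl
      rw [abs_lt]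
      constructor <;> linarith [h1.1, h1.2, h2.1, h2.2]
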